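/- Let n be a negative integer and let Q = [a,b,c] be an integral binary quadratic form of discriminant 4n and content k, so that d' := 4n/k² is the discriminant of the primitive form Q/k. Then, as T → ∞, F_T^Q = 6T/(ω(d')·π·|n|^{1/2}) + o(T). -/

import Mathlib

open Filter Real Asymptotics

/-- The substitution action of `SL₂(ℤ)` on integral binary quadratic forms, where a form
`a x² + b x y + c y²` is encoded as the triple `(a, b, c)`: for `g = (p q; r s)` the form
`g • Q` is `(x, y) ↦ Q (p x + q y, r x + s y)`. -/
def actForm (g : Matrix.SpecialLinearGroup (Fin 2) ℤ) (Q : ℤ × ℤ × ℤ) : ℤ × ℤ × ℤ :=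
  let p := (g : Matrix (Fin 2) (Fin 2) ℤ) 0 0
  let q := (g : Matrix (Fin 2) (Fin 2) ℤ) 0 1
  let r := (g : Matrix (Fin 2) (Fin 2) ℤ) 1 0
  let s := (g : Matrix (Fin 2) (Fin 2) ℤ) 1 1
  (Q.1 * p ^ 2 + Q.2.1 * p * r + Q.2.2 * r ^ 2,
   2 * Q.1 * p * q + Q.2.1 * (p * s + q * r) + 2 * Q.2.2 * r * s,
   Q.1 * q ^ 2 + Q.2.1 * q * s + Q.2.2 * s ^ 2)

/-- Proper (`SL₂(ℤ)`) equivalence of integral binary quadratic forms. -/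
def ProperEquiv (Q Q' : ℤ × ℤ × ℤ) : Prop := ∃ g, actForm g Q = Q'

/-- `DTQ n Q T` is the number of `D(n)`-pairs `{a, c}` (written with `a > c`) with
`a, c ∈ {-T, …, T}` whose associated form `E_{ac} = [a, 2√(ac+n), c]` is properly
equivalent to `Q`. -/
noncomputable def DTQ (n : ℤ) (Q : ℤ × ℤ × ℤ) (T : ℝ) : ℕ :=
  Set.ncard {ac : ℤ × ℤ | ac.2 < ac.1 ∧ ac.1 ≠ 0 ∧ ac.2 ≠ 0 ∧
    |(ac.1 : ℝ)| ≤ T ∧ |(ac.2 : ℝ)| ≤ T ∧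
    ∃ b : ℤ, 0 ≤ b ∧ b ^ 2 = ac.1 * ac.2 + n ∧ ProperEquiv (ac.1, 2 * b, ac.2) Q}

/-- `FTQ Q T` is the number of integral binary quadratic forms `[a, b, c]` with
`|a| ≤ T`, `|c| ≤ T`, `a > c`, `b ≥ 0` which are properly equivalent to `Q`. -/
noncomputable def FTQ (Q : ℤ × ℤ × ℤ) (T : ℝ) : ℕ :=
  Set.ncard {f : ℤ × ℤ × ℤ | |(f.1 : ℝ)| ≤ T ∧ |(f.2.2 : ℝ)| ≤ T ∧
    f.2.2 < f.1 ∧ 0 ≤ f.2.1 ∧ ProperEquiv f Q}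

/-- `ω(d)`: the number of `SL₂(ℤ)`-automorphs of a primitive definite form of
discriminant `d`. -/
def omegaDisc (d : ℤ) : ℕ := if d = -4 then 4 else if d = -3 then 6 else 2

lemma actForm_mul (g h : Matrix.SpecialLinearGroup (Fin 2) ℤ) (Q : ℤ × ℤ × ℤ) :
    actForm (g * h) Q = actForm h (actForm g Q) := by
  simp only [actForm, Matrix.SpecialLinearGroup.coe_mul, Matrix.mul_apply, Fin.sum_univ_two,
    Prod.mk.injEq]
  refine ⟨?_, ?_, ?_⟩ <;> ring

lemma actForm_one (Q : ℤ × ℤ × ℤ) : actForm 1 Q = Q := by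
  simp [actForm]

lemma actForm_mk (p q r s A B C : ℤ) (h : (!![p, q; r, s]).det = 1) :
    actForm ⟨!![p, q; r, s], h⟩ (A, B, C) =
      (A * p ^ 2 + B * p * r + C * r ^ 2,
        2 * A * p * q + B * (p * s + q * r) + 2 * C * r * s,
        A * q ^ 2 + B * q * s + C * s ^ 2) := rfl

lemma actForm_neg (g : Matrix.SpecialLinearGroup (Fin 2) ℤ) (Q : ℤ × ℤ × ℤ) :
    actForm g (-Q) = -actForm g Q := by
  simp only [actForm, Prod.fst_neg, Prod.snd_neg, Prod.neg_mk, Prod.mk.injEq]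
  refine ⟨?_, ?_, ?_⟩ <;> ring

lemma actForm_inv_eq_iff (g : Matrix.SpecialLinearGroup (Fin 2) ℤ) (Q R : ℤ × ℤ × ℤ) :
    actForm g⁻¹ R = Q ↔ actForm g Q = R := by
  constructor
  · rintro rfl
    rw [← actForm_mul, inv_mul_cancel, actForm_one]
  · rintro rfl
    rw [← actForm_mul, mul_inv_cancel, actForm_one]

lemma properEquiv_iff_exists_actForm_eq (Q R : ℤ × ℤ × ℤ) :
    ProperEquiv R Q ↔ ∃ g, actForm g Q = R := by
  constructor
  · rintro ⟨g, hg⟩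
    exact ⟨g⁻¹, (actForm_inv_eq_iff g R Q).2 hg⟩
  · rintro ⟨g, hg⟩
    exact ⟨g⁻¹, (actForm_inv_eq_iff g Q R).2 hg⟩

/-- The action preserves the discriminant. -/
lemma disc_actForm (g : Matrix.SpecialLinearGroup (Fin 2) ℤ) (Q : ℤ × ℤ × ℤ) :
    (actForm g Q).2.1 ^ 2 - 4 * (actForm g Q).1 * (actForm g Q).2.2 =
      Q.2.1 ^ 2 - 4 * Q.1 * Q.2.2 := by
  have h := g.det_coe
  rw [Matrix.det_fin_two] at h
  simp only [actForm]
  linear_combination (Q.2.1 ^ 2 - 4 * Q.1 * Q.2.2) *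
    ((g : Matrix (Fin 2) (Fin 2) ℤ) 0 0 * (g : Matrix (Fin 2) (Fin 2) ℤ) 1 1 -
      (g : Matrix (Fin 2) (Fin 2) ℤ) 0 1 * (g : Matrix (Fin 2) (Fin 2) ℤ) 1 0 + 1) * h

/-- Counting the forms of a set `K` in the orbit of `Q` by counting the matrices which carry `Q`
into `K`: each form is hit once for every automorph of `Q`. -/
lemma card_actForm_mem (K : Set (ℤ × ℤ × ℤ)) (Q : ℤ × ℤ × ℤ) :
    Nat.card {g | actForm g Q ∈ K} =
      Nat.card {f | f ∈ K ∧ ProperEquiv f Q} * Nat.card {g | actForm g Q = Q} := by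
  rw [← Nat.card_prod]
  let φ : {g | actForm g Q ∈ K} → {f | f ∈ K ∧ ProperEquiv f Q} := fun g =>
    ⟨actForm g Q, g.2, (properEquiv_iff_exists_actForm_eq _ _).2 ⟨g, rfl⟩⟩
  refine Nat.card_congr ((Equiv.sigmaFiberEquiv φ).symm.trans
    (Equiv.sigmaEquivProdOfEquiv fun f => ?_))
  have hf := (properEquiv_iff_exists_actForm_eq _ _).1 f.2.2
  let g₀ := hf.choose
  have hg₀ : actForm g₀ Q = f := hf.choose_spec
  have hg₀' : actForm g₀⁻¹ f = Q := (actForm_inv_eq_iff _ _ _).2 hg₀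
  exact
    { toFun := fun g => ⟨g.1.1 * g₀⁻¹, by
        have h : actForm g.1.1 Q = f := congrArg Subtype.val g.2
        simp only [Set.mem_ofPred_eq, actForm_mul, h, hg₀']⟩
      invFun := fun h => ⟨⟨h.1 * g₀, by
          have hh : actForm h.1 Q = Q := h.2
          simpa only [Set.mem_ofPred_eq, actForm_mul, hh, hg₀] using f.2.1⟩, by
          have hh : actForm h.1 Q = Q := h.2
          apply Subtype.ext
          simp only [φ, actForm_mul, hh, hg₀]⟩
      left_inv := fun g => by ext1; ext1; simp
      right_inv := fun h => by ext1; simp }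

lemma FTQ_neg (Q : ℤ × ℤ × ℤ) (T : ℝ) : FTQ (-Q) T = FTQ Q T := by
  have key : ∀ (x y z : ℤ) (Q : ℤ × ℤ × ℤ), ProperEquiv (x, y, z) Q →
      ProperEquiv (-z, y, -x) (-Q) := by
    rintro x y z Q ⟨g, hg⟩
    refine ⟨ModularGroup.S * g, ?_⟩
    have : actForm ModularGroup.S (-z, y, -x) = -(x, y, z) := by
      simp [actForm, ModularGroup.S]
    rw [actForm_mul, this, actForm_neg, hg]
  unfold FTQ
  refine Set.ncard_congr (fun f _ => (-f.2.2, f.2.1, -f.1)) ?_ ?_ ?_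
  · rintro ⟨x, y, z⟩ ⟨h1, h2, h3, h4, h5⟩
    refine ⟨by simpa using h2, by simpa using h1, by simpa using h3, h4, ?_⟩
    simpa using key x y z _ h5
  · rintro ⟨x, y, z⟩ ⟨x', y', z'⟩ _ _ h
    simp only [Prod.mk.injEq, neg_inj] at h ⊢
    tauto
  · rintro ⟨x, y, z⟩ ⟨h1, h2, h3, h4, h5⟩
    exact ⟨(-z, y, -x), ⟨by simpa using h2, by simpa using h1, by simpa using h3, h4,
      key x y z _ h5⟩, by simp⟩

/-- The solutions of the Pell equation `t² - d u² = 4` for a negative discriminant `d`. -/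
lemma card_pell_eq_omegaDisc {d : ℤ} (hd : d ≤ -3) :
    Nat.card {x : ℤ × ℤ | x.1 ^ 2 - d * x.2 ^ 2 = 4} = omegaDisc d := by
  rw [Nat.card_coe_set_eq]
  have bound : ∀ t u : ℤ, t ^ 2 - d * u ^ 2 = 4 → -2 ≤ t ∧ t ≤ 2 ∧ -1 ≤ u ∧ u ≤ 1 := by
    intro t u h
    refine ⟨?_, ?_, ?_, ?_⟩ <;> nlinarith [sq_nonneg t, sq_nonneg u]
  unfold omegaDisc
  split_ifs with h4 h3
  · subst h4
    have : {x : ℤ × ℤ | x.1 ^ 2 - (-4) * x.2 ^ 2 = 4} =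
        (({(2, 0), (-2, 0), (0, 1), (0, -1)} : Finset (ℤ × ℤ)) : Set (ℤ × ℤ)) := by
      ext ⟨t, u⟩
      simp only [Set.mem_ofPred_eq, Finset.coe_insert, Finset.coe_singleton, Set.mem_insert_iff,
        Set.mem_singleton_iff, Prod.mk.injEq]
      constructor
      · intro h
        obtain ⟨h1, h2, h3, h4⟩ := bound t u h
        interval_cases t <;> interval_cases u <;> omega
      · rintro (⟨rfl, rfl⟩ | ⟨rfl, rfl⟩ | ⟨rfl, rfl⟩ | ⟨rfl, rfl⟩) <;> norm_num
    rw [this, Set.ncard_coe_finset]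
    rfl
  · subst h3
    have : {x : ℤ × ℤ | x.1 ^ 2 - (-3) * x.2 ^ 2 = 4} =
        (({(2, 0), (-2, 0), (1, 1), (1, -1), (-1, 1), (-1, -1)} : Finset (ℤ × ℤ)) :
          Set (ℤ × ℤ)) := by
      ext ⟨t, u⟩
      simp only [Set.mem_ofPred_eq, Finset.coe_insert, Finset.coe_singleton, Set.mem_insert_iff,
        Set.mem_singleton_iff, Prod.mk.injEq]
      constructor
      · intro h
        obtain ⟨h1, h2, h3, h4⟩ := bound t u h
        interval_cases t <;> interval_cases u <;> omega
      · rintro (⟨rfl, rfl⟩ | ⟨rfl, rfl⟩ | ⟨rfl, rfl⟩ | ⟨rfl, rfl⟩ | ⟨rfl, rfl⟩ | ⟨rfl, rfl⟩) <;>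
          norm_num
    rw [this, Set.ncard_coe_finset]
    rfl
  · have : {x : ℤ × ℤ | x.1 ^ 2 - d * x.2 ^ 2 = 4} =
        (({(2, 0), (-2, 0)} : Finset (ℤ × ℤ)) : Set (ℤ × ℤ)) := by
      ext ⟨t, u⟩
      simp only [Set.mem_ofPred_eq, Finset.coe_insert, Finset.coe_singleton, Set.mem_insert_iff,
        Set.mem_singleton_iff, Prod.mk.injEq]
      constructor
      · intro h
        obtain ⟨h1, h2, h5, h6⟩ := bound t u h
        interval_cases t <;> interval_cases u <;> omega
      · rintro (⟨rfl, rfl⟩ | ⟨rfl, rfl⟩) <;> norm_num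
    rw [this, Set.ncard_coe_finset]
    rfl

/-- The automorphs of `k(a x² + b x y + c y²)`, with `a x² + b x y + c y²` primitive, are
parametrized by the solutions of the Pell equation `t² - d u² = 4`. -/
lemma card_automorphs_eq_card_pell {a b c k : ℤ} (ha : a ≠ 0) (hk : k ≠ 0)
    (hprim : Int.gcd a (Int.gcd b c) = 1) :
    Nat.card {g | actForm g (k * a, k * b, k * c) = (k * a, k * b, k * c)} =
      Nat.card {x : ℤ × ℤ | x.1 ^ 2 - (b ^ 2 - 4 * a * c) * x.2 ^ 2 = 4} := by
  symm
  have half : ∀ x : {x : ℤ × ℤ | x.1 ^ 2 - (b ^ 2 - 4 * a * c) * x.2 ^ 2 = 4},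
      ∃ p : ℤ, x.1.1 = 2 * p + b * x.1.2 := by
    rintro ⟨⟨t, u⟩, h⟩
    simp only [Set.mem_ofPred_eq] at h
    have h2 : (2 : ℤ) ∣ (t - b * u) * (t + b * u) :=
      ⟨2 - 2 * a * c * u ^ 2, by linear_combination h⟩
    have h3 : (2 : ℤ) ∣ t - b * u := by
      rcases Int.prime_two.dvd_or_dvd h2 with h | h
      · exact h
      · have : t - b * u = t + b * u - 2 * (b * u) := by ring
        rw [this]
        exact dvd_sub h (dvd_mul_right _ _)
    obtain ⟨p, hp⟩ := h3
    exact ⟨p, by simp only; linarith⟩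
  choose p hp using half
  have hdet : ∀ x, (!![p x, -c * x.1.2; a * x.1.2, p x + b * x.1.2]).det = 1 := by
    intro x
    rw [Matrix.det_fin_two_of]
    have h := x.2
    simp only [Set.mem_ofPred_eq, hp x] at h
    linarith
  let φ : {x : ℤ × ℤ | x.1 ^ 2 - (b ^ 2 - 4 * a * c) * x.2 ^ 2 = 4} →
      {g | actForm g (k * a, k * b, k * c) = (k * a, k * b, k * c)} := fun x =>
    ⟨⟨!![p x, -c * x.1.2; a * x.1.2, p x + b * x.1.2], hdet x⟩, by
      have h := hdet x
      rw [Matrix.det_fin_two_of] at h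
      change actForm ⟨_, hdet x⟩ _ = _
      rw [actForm_mk, Prod.mk.injEq, Prod.mk.injEq]
      refine ⟨?_, ?_, ?_⟩
      · linear_combination k * a * h
      · linear_combination k * b * h
      · linear_combination k * c * h⟩
  refine Nat.card_congr (Equiv.ofBijective φ ⟨?_, ?_⟩)
  · intro x y hxy
    have h := congrArg (fun g => (g.1 : Matrix (Fin 2) (Fin 2) ℤ)) hxy
    have h00 : p x = p y := congrFun (congrFun h 0) 0
    have h10 : a * x.1.2 = a * y.1.2 := congrFun (congrFun h 1) 0
    have hu : x.1.2 = y.1.2 := mul_left_cancel₀ ha h10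
    exact Subtype.ext (Prod.ext (by rw [hp x, hp y, h00, hu]) hu)
  · rintro ⟨g, hg⟩
    have hd := g.det_coe
    rw [Matrix.det_fin_two] at hd
    simp only [Set.mem_ofPred_eq, actForm, Prod.mk.injEq] at hg
    obtain ⟨h1, h2, h3⟩ := hg
    set P := (g : Matrix (Fin 2) (Fin 2) ℤ) 0 0 with hP
    set q := (g : Matrix (Fin 2) (Fin 2) ℤ) 0 1 with hq
    set r := (g : Matrix (Fin 2) (Fin 2) ℤ) 1 0 with hr
    set s := (g : Matrix (Fin 2) (Fin 2) ℤ) 1 1 with hs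
    have e1 : a * P ^ 2 + b * P * r + c * r ^ 2 = a :=
      mul_left_cancel₀ hk (by linear_combination h1)
    have e2 : 2 * a * P * q + b * (P * s + q * r) + 2 * c * r * s = b :=
      mul_left_cancel₀ hk (by linear_combination h2)
    have e3 : a * q ^ 2 + b * q * s + c * s ^ 2 = c :=
      mul_left_cancel₀ hk (by linear_combination h3)
    have f1 : a * (s - P) = b * r := by
      have : 2 * (a * (s - P)) = 2 * (b * r) := by
        linear_combination (2 * a * P + 2 * b * r) * hd - 2 * s * e1 + r * e2 - b * r * hd
      linarith
    have f2 : a * q = -c * r := by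
      have : 2 * (a * q) = 2 * (-c * r) := by
        linear_combination -2 * q * e1 + P * e2 - 2 * c * r * hd - b * P * hd
      linarith
    have har : a ∣ r := by
      have hb : a ∣ r * b := ⟨s - P, by linarith⟩
      have hc : a ∣ r * c := ⟨-q, by linarith⟩
      have hbc : a ∣ r * (Int.gcd b c : ℤ) := by
        rw [Int.gcd_eq_gcd_ab, mul_add, ← mul_assoc, ← mul_assoc]
        exact dvd_add (hb.mul_right _) (hc.mul_right _)
      exact (Int.isCoprime_iff_gcd_eq_one.2 hprim).dvd_of_dvd_mul_right hbc
    obtain ⟨u, hu⟩ := har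
    have hsP : s - P = b * u := mul_left_cancel₀ ha (by rw [f1, hu]; ring)
    have hqu : q = -c * u := mul_left_cancel₀ ha (by rw [f2, hu]; ring)
    have hmem : (P + s) ^ 2 - (b ^ 2 - 4 * a * c) * u ^ 2 = 4 := by
      have hs' : s = P + b * u := by linarith
      rw [hs', hqu, hu] at hd
      rw [hs']
      linear_combination 4 * hd
    refine ⟨⟨(P + s, u), hmem⟩, ?_⟩
    have hpx := hp ⟨(P + s, u), hmem⟩
    simp only at hpx
    have hpP : p ⟨(P + s, u), hmem⟩ = P := by linarith
    apply Subtype.ext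
    ext i j
    fin_cases i <;> fin_cases j
    · exact hpP
    · exact hqu.symm
    · exact hu.symm
    · change p ⟨(P + s, u), hmem⟩ + b * u = s
      rw [hpP]
      linarith

/-- The form `a x² + b x y + c y²` evaluated at a vector. -/
def evalForm (Q : ℤ × ℤ × ℤ) (u : ℤ × ℤ) : ℤ :=
  Q.1 * u.1 ^ 2 + Q.2.1 * u.1 * u.2 + Q.2.2 * u.2 ^ 2

lemma evalForm_pos {a b c n : ℤ} (ha : 0 < a) (hn : n < 0) (hdisc : b ^ 2 - 4 * a * c = 4 * n)
    {u : ℤ × ℤ} (hu : u ≠ 0) : 0 < evalForm (a, b, c) u := by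
  obtain ⟨x, y⟩ := u
  have key : 4 * a * evalForm (a, b, c) (x, y) = (2 * a * x + b * y) ^ 2 + 4 * (-n) * y ^ 2 := by
    simp only [evalForm]
    linear_combination -y ^ 2 * hdisc
  have hpos : 0 < (2 * a * x + b * y) ^ 2 + 4 * (-n) * y ^ 2 := by
    rcases eq_or_ne y 0 with rfl | hy
    · have hx : x ≠ 0 := by rintro rfl; exact hu rfl
      have : 2 * a * x ≠ 0 := by positivity
      simpa using sq_pos_of_ne_zero this
    · have : 0 < -n := by linarith
      positivity
  rw [← key] at hpos
  exact pos_of_mul_pos_right hpos (by linarith)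

lemma finite_evalForm_le {a b c n : ℤ} (ha : 0 < a) (hn : n < 0)
    (hdisc : b ^ 2 - 4 * a * c = 4 * n) (T : ℝ) :
    {u : ℤ × ℤ | (evalForm (a, b, c) u : ℝ) ≤ T}.Finite := by
  have hc : 0 < c := by nlinarith [sq_nonneg b]
  set M : ℤ := (a + c) * ⌊T⌋
  refine (Set.finite_Icc ((-M, -M) : ℤ × ℤ) (M, M)).subset ?_
  rintro ⟨x, y⟩ h
  have h' : evalForm (a, b, c) (x, y) ≤ ⌊T⌋ := Int.le_floor.2 h
  have k1 : 4 * a * evalForm (a, b, c) (x, y) = (2 * a * x + b * y) ^ 2 + 4 * (-n) * y ^ 2 := by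
    simp only [evalForm]
    linear_combination -y ^ 2 * hdisc
  have k2 : 4 * c * evalForm (a, b, c) (x, y) = (2 * c * y + b * x) ^ 2 + 4 * (-n) * x ^ 2 := by
    simp only [evalForm]
    linear_combination -x ^ 2 * hdisc
  have hT : 0 ≤ ⌊T⌋ := by
    refine le_trans ?_ h'
    rcases eq_or_ne (x, y) 0 with h0 | h0
    · rw [h0]; simp [evalForm]
    · exact (evalForm_pos ha hn hdisc h0).le
  have hy : y ^ 2 ≤ M := by
    nlinarith [sq_nonneg (2 * a * x + b * y), sq_nonneg y,
      mul_nonneg hc.le hT, mul_le_mul_of_nonneg_left h' ha.le]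
  have hx : x ^ 2 ≤ M := by
    nlinarith [sq_nonneg (2 * c * y + b * x), sq_nonneg x,
      mul_nonneg ha.le hT, mul_le_mul_of_nonneg_left h' hc.le]
  have hx1 := Int.le_self_sq x
  have hx2 := Int.le_self_sq (-x)
  have hy1 := Int.le_self_sq y
  have hy2 := Int.le_self_sq (-y)
  simp only [Set.mem_Icc, Prod.mk_le_mk]
  refine ⟨⟨?_, ?_⟩, ?_, ?_⟩ <;> nlinarith

/-- The conditions on the coefficients of the forms counted by `FTQ`. -/
def coeffRegion (T : ℝ) : Set (ℤ × ℤ × ℤ) :=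
  {f | |(f.1 : ℝ)| ≤ T ∧ |(f.2.2 : ℝ)| ≤ T ∧ f.2.2 < f.1 ∧ 0 ≤ f.2.1}

/-- The primitive vectors at which the form `Q` is at most `T`. -/
def primitiveVectors (Q : ℤ × ℤ × ℤ) (T : ℝ) : Set (ℤ × ℤ) :=
  {u | (evalForm Q u : ℝ) ≤ T ∧ Int.gcd u.1 u.2 = 1}

/-- For a form with `c < a` and `b ≥ 0`, the middle coefficient is less than `2a`. -/
lemma middle_coeff_lt {a b c n : ℤ} (ha : 0 < a) (hn : n < 0) (hb : 0 ≤ b) (hca : c < a)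
    (hdisc : b ^ 2 - 4 * a * c = 4 * n) : b < 2 * a := by
  by_contra! h
  nlinarith

/-- A matrix carrying a definite form into `coeffRegion T` is determined by its first column. -/
lemma injOn_firstColumn {a b c n : ℤ} (ha : 0 < a) (hn : n < 0)
    (hdisc : b ^ 2 - 4 * a * c = 4 * n) (T : ℝ) :
    Set.InjOn (fun g : Matrix.SpecialLinearGroup (Fin 2) ℤ =>
      ((g : Matrix (Fin 2) (Fin 2) ℤ) 0 0, (g : Matrix (Fin 2) (Fin 2) ℤ) 1 0))
      {g | actForm g (a, b, c) ∈ coeffRegion T} := by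
  intro g hg g' hg' h
  have d := disc_actForm g (a, b, c)
  have d' := disc_actForm g' (a, b, c)
  obtain ⟨-, -, h3, h4⟩ := hg
  obtain ⟨-, -, h3', h4'⟩ := hg'
  simp only [hdisc] at d d'
  have e := g.det_coe
  have e' := g'.det_coe
  rw [Matrix.det_fin_two] at e e'
  simp only [Prod.mk.injEq] at h
  obtain ⟨hp, hr⟩ := h
  have hu : ((g : Matrix (Fin 2) (Fin 2) ℤ) 0 0, (g : Matrix (Fin 2) (Fin 2) ℤ) 1 0) ≠ 0 := by
    intro h0
    simp only [Prod.mk_eq_zero] at h0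
    rw [h0.1, h0.2] at e
    simp at e
  have hA : 0 < (actForm g (a, b, c)).1 := evalForm_pos ha hn hdisc hu
  have hAA : (actForm g' (a, b, c)).1 = (actForm g (a, b, c)).1 := by
    simp only [actForm, hp, hr]
  have b1 := middle_coeff_lt hA hn h4 h3 d
  have b2 := middle_coeff_lt (by rwa [hAA]) hn h4' h3' d'
  rw [hAA] at b2
  set A := (actForm g (a, b, c)).1 with hAdef
  have hB : (actForm g (a, b, c)).2.1 = 2 * a * (g : Matrix (Fin 2) (Fin 2) ℤ) 0 0 *
    (g : Matrix (Fin 2) (Fin 2) ℤ) 0 1 + b * ((g : Matrix (Fin 2) (Fin 2) ℤ) 0 0 *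
    (g : Matrix (Fin 2) (Fin 2) ℤ) 1 1 + (g : Matrix (Fin 2) (Fin 2) ℤ) 0 1 *
    (g : Matrix (Fin 2) (Fin 2) ℤ) 1 0) + 2 * c * (g : Matrix (Fin 2) (Fin 2) ℤ) 1 0 *
    (g : Matrix (Fin 2) (Fin 2) ℤ) 1 1 := rfl
  have hB' : (actForm g' (a, b, c)).2.1 = 2 * a * (g' : Matrix (Fin 2) (Fin 2) ℤ) 0 0 *
    (g' : Matrix (Fin 2) (Fin 2) ℤ) 0 1 + b * ((g' : Matrix (Fin 2) (Fin 2) ℤ) 0 0 *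
    (g' : Matrix (Fin 2) (Fin 2) ℤ) 1 1 + (g' : Matrix (Fin 2) (Fin 2) ℤ) 0 1 *
    (g' : Matrix (Fin 2) (Fin 2) ℤ) 1 0) + 2 * c * (g' : Matrix (Fin 2) (Fin 2) ℤ) 1 0 *
    (g' : Matrix (Fin 2) (Fin 2) ℤ) 1 1 := rfl
  have hA' : A = a * (g : Matrix (Fin 2) (Fin 2) ℤ) 0 0 ^ 2 +
    b * (g : Matrix (Fin 2) (Fin 2) ℤ) 0 0 * (g : Matrix (Fin 2) (Fin 2) ℤ) 1 0 +
    c * (g : Matrix (Fin 2) (Fin 2) ℤ) 1 0 ^ 2 := rfl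
  rw [← hp, ← hr] at hB' e'
  rw [hB] at h4 b1
  rw [hB'] at h4' b2
  set p := (g : Matrix (Fin 2) (Fin 2) ℤ) 0 0
  set q := (g : Matrix (Fin 2) (Fin 2) ℤ) 0 1
  set r := (g : Matrix (Fin 2) (Fin 2) ℤ) 1 0
  set s := (g : Matrix (Fin 2) (Fin 2) ℤ) 1 1
  set q' := (g' : Matrix (Fin 2) (Fin 2) ℤ) 0 1
  set s' := (g' : Matrix (Fin 2) (Fin 2) ℤ) 1 1
  obtain ⟨t, hq, hs⟩ : ∃ t, q' = q + t * p ∧ s' = s + t * r :=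
    ⟨(q' - q) * s - (s' - s) * q, by linear_combination (q - q') * e - q * e + q * e',
      by linear_combination (s - s') * e - s * e + s * e'⟩
  have hBB : 2 * a * p * q' + b * (p * s' + q' * r) + 2 * c * r * s' =
      2 * a * p * q + b * (p * s + q * r) + 2 * c * r * s + 2 * A * t := by
    rw [hq, hs, hA']; ring
  rw [hBB] at h4' b2
  have ht1 : t < 1 := by by_contra! h; nlinarith
  have ht2 : -1 < t := by by_contra! h; nlinarith
  have ht : t = 0 := by omega
  subst ht
  ext i j
  fin_cases i <;> fin_cases j
  · exact hp
  · change q = q'; linarith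
  · exact hr
  · change s = s'; linarith

lemma firstColumn_mapsTo (a b c : ℤ) (T : ℝ) :
    Set.MapsTo (fun g : Matrix.SpecialLinearGroup (Fin 2) ℤ =>
      ((g : Matrix (Fin 2) (Fin 2) ℤ) 0 0, (g : Matrix (Fin 2) (Fin 2) ℤ) 1 0))
      {g | actForm g (a, b, c) ∈ coeffRegion T} (primitiveVectors (a, b, c) T) := by
  rintro g ⟨h1, -⟩
  refine ⟨(le_abs_self _).trans h1, ?_⟩
  rw [← Int.isCoprime_iff_gcd_eq_one]
  have e := g.det_coe
  rw [Matrix.det_fin_two] at e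
  exact ⟨(g : Matrix (Fin 2) (Fin 2) ℤ) 1 1, -(g : Matrix (Fin 2) (Fin 2) ℤ) 0 1,
    by linear_combination e⟩

lemma primitiveVectors_subset {a b c n : ℤ} (hn : n < 0)
    (hdisc : b ^ 2 - 4 * a * c = 4 * n) (T : ℝ) :
    primitiveVectors (a, b, c) T \ primitiveVectors (a, b, c) (-n : ℤ) ⊆
      (fun g : Matrix.SpecialLinearGroup (Fin 2) ℤ =>
        ((g : Matrix (Fin 2) (Fin 2) ℤ) 0 0, (g : Matrix (Fin 2) (Fin 2) ℤ) 1 0)) ''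
      {g | actForm g (a, b, c) ∈ coeffRegion T} := by
  rintro ⟨p, r⟩ ⟨⟨hT, hprim⟩, hlarge⟩
  set A := evalForm (a, b, c) (p, r) with hA
  have hAn : -n < A := by
    by_contra! h
    exact hlarge ⟨by exact_mod_cast h, hprim⟩
  have hA0 : 0 < A := by linarith
  obtain ⟨s₀, q₀, h₀⟩ := Int.isCoprime_iff_gcd_eq_one.2 hprim
  simp only at h₀
  set B := 2 * a * p * (-q₀) + b * (p * s₀ + (-q₀) * r) + 2 * c * r * s₀ with hB
  set t := -(B / (2 * A)) with ht
  have hdet : (!![p, -q₀ + t * p; r, s₀ + t * r]).det = 1 := by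
    rw [Matrix.det_fin_two_of]
    linear_combination h₀
  have hd := disc_actForm ⟨!![p, -q₀ + t * p; r, s₀ + t * r], hdet⟩ (a, b, c)
  have hAeq : (actForm ⟨!![p, -q₀ + t * p; r, s₀ + t * r], hdet⟩ (a, b, c)).1 = A := rfl
  have hBeq : (actForm ⟨!![p, -q₀ + t * p; r, s₀ + t * r], hdet⟩ (a, b, c)).2.1 =
      B % (2 * A) := by
    rw [actForm_mk, Int.emod_def]
    simp only [hB, ht, hA, evalForm]
    ring
  have m1 : 0 ≤ B % (2 * A) := Int.emod_nonneg _ (by positivity)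
  have m2 : B % (2 * A) < 2 * A := Int.emod_lt_of_pos _ (by positivity)
  refine ⟨⟨!![p, -q₀ + t * p; r, s₀ + t * r], hdet⟩, ?_, rfl⟩
  simp only [hdisc] at hd
  rw [hAeq, hBeq] at hd
  set C := (actForm ⟨!![p, -q₀ + t * p; r, s₀ + t * r], hdet⟩ (a, b, c)).2.2
  have hCA : C < A := by
    by_contra! h
    nlinarith
  have hC0 : 0 < C := by
    by_contra! h
    nlinarith [sq_nonneg (B % (2 * A))]
  have hAT : |(A : ℝ)| ≤ T := by
    rw [abs_of_pos (by exact_mod_cast hA0)]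
    exact hT
  refine ⟨hAT, le_trans ?_ hAT, hCA, by rw [hBeq]; exact m1⟩
  exact_mod_cast abs_le_abs_of_nonneg hC0.le hCA.le

/-- The number of matrices carrying a positive definite form into `coeffRegion T` is, up to a
bounded error, the number of primitive vectors at which the form is at most `T`. -/
lemma abs_card_actForm_mem_sub_le {a b c n : ℤ} (ha : 0 < a) (hn : n < 0)
    (hdisc : b ^ 2 - 4 * a * c = 4 * n) (T : ℝ) :
    |(Nat.card {g | actForm g (a, b, c) ∈ coeffRegion T} : ℝ) -
      (primitiveVectors (a, b, c) T).ncard| ≤ (primitiveVectors (a, b, c) (-n : ℤ)).ncard := by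
  have hfin : ∀ T, (primitiveVectors (a, b, c) T).Finite := fun T =>
    (finite_evalForm_le ha hn hdisc T).subset fun u hu => hu.1
  rw [Nat.card_coe_set_eq, ← (injOn_firstColumn ha hn hdisc T).ncard_image]
  have hsub := (firstColumn_mapsTo a b c T).image_subset
  have h1 := Set.ncard_le_ncard hsub (hfin T)
  have h2 := Set.ncard_le_ncard (primitiveVectors_subset hn hdisc T) ((hfin T).subset hsub)
  have h3 := Set.ncard_le_ncard_sdiff_add_ncard (primitiveVectors (a, b, c) T)
    (primitiveVectors (a, b, c) (-n : ℤ)) (hfin _)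
  have h4 := h3.trans (Nat.add_le_add_right h2 _)
  rw [abs_le]
  constructor
  · have : ((primitiveVectors (a, b, c) T).ncard : ℝ) ≤ _ := Nat.cast_le.2 h4
    push_cast at this ⊢
    linarith
  · have : (_ : ℝ) ≤ ((primitiveVectors (a, b, c) T).ncard : ℝ) := Nat.cast_le.2 h1
    have h0 : (0 : ℝ) ≤ ((primitiveVectors (a, b, c) (-n : ℤ)).ncard : ℝ) := Nat.cast_nonneg _
    linarith

/-- A filled ellipse is the preimage of the unit disc under a linear map. -/
lemma ellipse_eq_preimage {A B C D : ℝ} (hA : 0 < A) (hD : 0 < D)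
    (hdisc : 4 * D = 4 * A * C - B ^ 2) :
    {x : Fin 2 → ℝ | A * x 0 ^ 2 + B * x 0 * x 1 + C * x 1 ^ 2 ≤ 1} =
      Matrix.toLin' !![√A, B / (2 * √A); 0, √(D / A)] ⁻¹'
        (WithLp.toLp 2 ⁻¹' Metric.closedBall (0 : EuclideanSpace ℝ (Fin 2)) 1) := by
  ext x
  have h1 : √A ^ 2 = A := Real.sq_sqrt hA.le
  have h2 : √(D / A) ^ 2 = D / A := Real.sq_sqrt (by positivity)
  have h3 : √A ≠ 0 := (Real.sqrt_pos.2 hA).ne'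
  have key : A * x 0 ^ 2 + B * x 0 * x 1 + C * x 1 ^ 2 =
      (√A * x 0 + B / (2 * √A) * x 1) ^ 2 + (√(D / A) * x 1) ^ 2 := by
    have e : (√A * x 0 + B / (2 * √A) * x 1) ^ 2 =
        √A ^ 2 * x 0 ^ 2 + B * x 0 * x 1 + B ^ 2 / (4 * √A ^ 2) * x 1 ^ 2 := by
      field_simp
      ring
    rw [e, mul_pow, h1, h2]
    field_simp
    linear_combination -x 1 ^ 2 * hdisc
  simp only [Set.mem_preimage, Set.mem_ofPred_eq, mem_closedBall_zero_iff]
  rw [← sq_le_one_iff₀ (norm_nonneg _), EuclideanSpace.norm_sq_eq, key]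
  simp [Fin.sum_univ_two, Matrix.toLin'_apply, Matrix.mulVec, dotProduct]

lemma volume_ellipse {A B C D : ℝ} (hA : 0 < A) (hD : 0 < D)
    (hdisc : 4 * D = 4 * A * C - B ^ 2) :
    MeasureTheory.volume.real {x : Fin 2 → ℝ | A * x 0 ^ 2 + B * x 0 * x 1 + C * x 1 ^ 2 ≤ 1} =
      π / √D := by
  have hdet : LinearMap.det (Matrix.toLin' !![√A, B / (2 * √A); 0, √(D / A)]) = √D := by
    rw [LinearMap.det_toLin', Matrix.det_fin_two_of, mul_zero, sub_zero, ← Real.sqrt_mul hA.le,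
      mul_div_cancel₀ _ hA.ne']
  have hpos := Real.sqrt_pos.2 hD
  rw [ellipse_eq_preimage hA hD hdisc, MeasureTheory.measureReal_def,
    MeasureTheory.Measure.addHaar_preimage_linearMap _ (by rw [hdet]; exact hpos.ne'), hdet,
    (PiLp.volume_preserving_toLp (Fin 2)).measure_preimage
      Metric.isClosed_closedBall.measurableSet.nullMeasurableSet,
    EuclideanSpace.volume_closedBall_fin_two, ENNReal.ofReal_one, one_pow, one_mul,
    ENNReal.toReal_mul, ENNReal.toReal_ofReal (abs_nonneg _), ENNReal.toReal_ofReal Real.pi_pos.le,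
    abs_of_pos (inv_pos.2 hpos)]
  ring

lemma convex_ellipse {A B C D : ℝ} (hA : 0 < A) (hD : 0 < D)
    (hdisc : 4 * D = 4 * A * C - B ^ 2) :
    Convex ℝ {x : Fin 2 → ℝ | A * x 0 ^ 2 + B * x 0 * x 1 + C * x 1 ^ 2 ≤ 1} := by
  rw [ellipse_eq_preimage hA hD hdisc]
  exact ((convex_closedBall _ _).linear_preimage
    (WithLp.linearEquiv 2 ℝ (Fin 2 → ℝ)).symm.toLinearMap).linear_preimage _

lemma isBounded_ellipse {A B C D : ℝ} (hA : 0 < A) (hD : 0 < D)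
    (hdisc : 4 * D = 4 * A * C - B ^ 2) :
    Bornology.IsBounded {x : Fin 2 → ℝ | A * x 0 ^ 2 + B * x 0 * x 1 + C * x 1 ^ 2 ≤ 1} := by
  have hC : 0 < C := by nlinarith [sq_nonneg B]
  refine (Metric.isBounded_Icc (fun _ => -(1 + (A + C) / D) : Fin 2 → ℝ)
    (fun _ => 1 + (A + C) / D)).subset fun x hx => ?_
  rw [Set.mem_ofPred_eq] at hx
  have h0 : x 0 ^ 2 ≤ (A + C) / D := by
    rw [le_div_iff₀ hD]
    nlinarith [sq_nonneg (2 * C * x 1 + B * x 0), mul_le_mul_of_nonneg_left hx hC.le]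
  have h1 : x 1 ^ 2 ≤ (A + C) / D := by
    rw [le_div_iff₀ hD]
    nlinarith [sq_nonneg (2 * A * x 0 + B * x 1), mul_le_mul_of_nonneg_left hx hA.le]
  refine ⟨fun i => ?_, fun i => ?_⟩ <;> fin_cases i
  · change _ ≤ x 0
    nlinarith [sq_nonneg (x 0 + 1)]
  · change _ ≤ x 1
    nlinarith [sq_nonneg (x 1 + 1)]
  · change x 0 ≤ _
    nlinarith [sq_nonneg (x 0 - 1)]
  · change x 1 ≤ _
    nlinarith [sq_nonneg (x 1 - 1)]

/-- The number of lattice points in a growing ellipse is asymptotic to the area. -/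
lemma tendsto_ncard_evalForm_le_div {a b c n : ℤ} (ha : 0 < a) (hn : n < 0)
    (hdisc : b ^ 2 - 4 * a * c = 4 * n) :
    Tendsto (fun T : ℝ => ({u : ℤ × ℤ | (evalForm (a, b, c) u : ℝ) ≤ T}.ncard : ℝ) / T) atTop
      (nhds (π / √(-n : ℝ))) := by
  have hA : (0 : ℝ) < a := by exact_mod_cast ha
  have hD : (0 : ℝ) < -n := by
    have : (n : ℝ) < 0 := by exact_mod_cast hn
    linarith
  have hdisc' : 4 * (-n : ℝ) = 4 * a * c - (b : ℝ) ^ 2 := by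
    have : (b : ℝ) ^ 2 - 4 * a * c = 4 * n := by exact_mod_cast hdisc
    linarith
  let F : (Fin 2 → ℝ) → ℝ := fun x => a * x 0 ^ 2 + b * x 0 * x 1 + c * x 1 ^ 2
  have hF : Continuous F := by fun_prop
  let L : Submodule ℤ (Fin 2 → ℝ) := Submodule.span ℤ (Set.range (Pi.basisFun ℝ (Fin 2)))
  have hcov : ZLattice.covolume L = 1 := by
    rw [ZLattice.covolume_eq_measure_fundamentalDomain L MeasureTheory.volume
      (ZSpan.isAddFundamentalDomain (Pi.basisFun ℝ (Fin 2)) _),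
      ZSpan.fundamentalDomain_pi_basisFun, MeasureTheory.measureReal_def, Real.volume_pi_Ico]
    simp
  have key := ZLattice.covolume.tendsto_card_le_div L (X := Set.univ) (F := F)
    (fun _ _ _ _ => Set.mem_univ _)
    (by
      intro x r _
      simp only [F, Pi.smul_apply, smul_eq_mul, Fintype.card_fin]
      ring)
    (by simpa only [Set.mem_univ, true_and] using isBounded_ellipse hA hD hdisc')
    (by
      simp only [Set.mem_univ, true_and]
      exact (isClosed_le hF continuous_const).measurableSet)
    (by
      simp only [Set.mem_univ, true_and]
      exact (convex_ellipse hA hD hdisc').addHaar_frontier _)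
  simp only [Set.mem_univ, true_and] at key
  rw [hcov, div_one, volume_ellipse hA hD hdisc'] at key
  refine key.congr fun T => ?_
  congr 2
  rw [Nat.card_coe_set_eq]
  symm
  refine Set.ncard_congr (fun u _ => ![(u.1 : ℝ), (u.2 : ℝ)]) ?_ ?_ ?_
  · intro u hu
    refine ⟨?_, ?_⟩
    · simpa [F, evalForm] using hu
    · rw [SetLike.mem_coe, Module.Basis.mem_span_iff_repr_mem]
      intro i
      fin_cases i
      · exact ⟨u.1, by simp⟩
      · exact ⟨u.2, by simp⟩
  · intro u v _ _ h
    have h0 := congrFun h 0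
    have h1 := congrFun h 1
    simp only [Matrix.cons_val_zero, Matrix.cons_val_one, Int.cast_inj] at h0 h1
    exact Prod.ext h0 h1
  · rintro x ⟨hx, hxL⟩
    rw [SetLike.mem_coe, Module.Basis.mem_span_iff_repr_mem] at hxL
    obtain ⟨y, hy⟩ := hxL 0
    obtain ⟨z, hz⟩ := hxL 1
    simp only [Pi.basisFun_repr, algebraMap_int_eq, eq_intCast] at hy hz
    refine ⟨(y, z), ?_, ?_⟩
    · simpa [F, evalForm, hy, hz] using hx
    · ext i
      fin_cases i
      · exact hy
      · exact hz

open scoped ArithmeticFunction.Moebius ArithmeticFunction.zeta in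
lemma tsum_moebius_div_sq : ∑' d : ℕ, (μ d : ℝ) / (d : ℝ) ^ 2 = 6 / π ^ 2 := by
  have h := LSeries_one_mul_Lseries_moebius (s := 2) (by norm_num)
  rw [LSeries_one_eq_riemannZeta (by norm_num), riemannZeta_two] at h
  have h' : LSeries (fun d => ((μ d : ℤ) : ℂ)) 2 =
      ((∑' d : ℕ, (μ d : ℝ) / (d : ℝ) ^ 2 : ℝ) : ℂ) := by
    rw [LSeries, Complex.ofReal_tsum]
    refine tsum_congr fun d => ?_
    rcases eq_or_ne d 0 with rfl | hd
    · simp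
    · rw [LSeries.term_of_ne_zero hd]
      push_cast
      norm_cast
  rw [h'] at h
  have h2 : π ^ 2 / 6 * ∑' d : ℕ, (μ d : ℝ) / (d : ℝ) ^ 2 = 1 := by exact_mod_cast h
  have hpi := Real.pi_pos
  field_simp at h2 ⊢
  linarith

/-- The nonzero vectors at which the form `Q` is at most `T`. -/
def nonzeroVectors (Q : ℤ × ℤ × ℤ) (T : ℝ) : Set (ℤ × ℤ) :=
  {u | u ≠ 0 ∧ (evalForm Q u : ℝ) ≤ T}

lemma evalForm_mul (Q : ℤ × ℤ × ℤ) (d x y : ℤ) :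
    evalForm Q (d * x, d * y) = d ^ 2 * evalForm Q (x, y) := by
  simp only [evalForm]
  ring

lemma nonzeroVectors_div_sq (Q : ℤ × ℤ × ℤ) (T : ℝ) {d : ℕ} (hd : d ≠ 0) :
    (nonzeroVectors Q (T / d ^ 2)).ncard =
      {u ∈ nonzeroVectors Q T | d ∣ Int.gcd u.1 u.2}.ncard := by
  have hd' : (0 : ℝ) < (d : ℝ) ^ 2 := by positivity
  have hdz : (d : ℤ) ≠ 0 := by exact_mod_cast hd
  refine Set.ncard_congr (fun u _ => ((d : ℤ) * u.1, (d : ℤ) * u.2)) ?_ ?_ ?_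
  · rintro ⟨x, y⟩ ⟨h0, h⟩
    refine ⟨⟨?_, ?_⟩, ?_⟩
    · contrapose! h0
      simpa [hd] using h0
    · rw [evalForm_mul]
      push_cast
      rw [le_div_iff₀ hd'] at h
      linarith
    · rw [Int.gcd_mul_left]
      simp
  · rintro ⟨x, y⟩ ⟨x', y'⟩ _ _ h
    simpa [hd] using h
  · rintro ⟨x, y⟩ ⟨⟨h0, h⟩, hdvd⟩
    obtain ⟨x', rfl⟩ : (d : ℤ) ∣ x := (Int.natCast_dvd_natCast.2 hdvd).trans (Int.gcd_dvd_left _ _)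
    obtain ⟨y', rfl⟩ : (d : ℤ) ∣ y := (Int.natCast_dvd_natCast.2 hdvd).trans (Int.gcd_dvd_right _ _)
    refine ⟨(x', y'), ⟨?_, ?_⟩, rfl⟩
    · rintro h
      simp only [Prod.mk_eq_zero] at h
      exact h0 (by simp [h.1, h.2])
    · rw [evalForm_mul] at h
      push_cast at h
      rw [le_div_iff₀ hd']
      linarith

lemma sum_divisors_moebius (m : ℕ) :
    ∑ d ∈ m.divisors, (ArithmeticFunction.moebius d : ℝ) = if m = 1 then 1 else 0 := by
  have h := congrArg (fun f : ArithmeticFunction ℤ => f m)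
    ArithmeticFunction.moebius_mul_coe_zeta
  simp only [ArithmeticFunction.coe_mul_zeta_apply, ArithmeticFunction.one_apply] at h
  exact_mod_cast h

/-- Möbius inversion for the number of primitive vectors. -/
lemma ncard_primitiveVectors_eq_tsum {Q : ℤ × ℤ × ℤ}
    (hfin : ∀ T : ℝ, {u : ℤ × ℤ | (evalForm Q u : ℝ) ≤ T}.Finite) (T : ℝ) :
    ((primitiveVectors Q T).ncard : ℝ) = ∑' d : ℕ, (ArithmeticFunction.moebius d : ℝ) *
      (nonzeroVectors Q (T / (d : ℝ) ^ 2)).ncard := by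
  classical
  have hS : (nonzeroVectors Q T).Finite := (hfin T).subset fun u hu => hu.2
  have hgcd : ∀ u ∈ hS.toFinset, Int.gcd u.1 u.2 ≠ 0 := by
    intro u hu h
    rw [Int.gcd_eq_zero_iff] at h
    exact (hS.mem_toFinset.1 hu).1 (Prod.ext h.1 h.2)
  have hsingle : ∀ u ∈ hS.toFinset, HasSum (fun d : ℕ => if d ∣ Int.gcd u.1 u.2 then
      (ArithmeticFunction.moebius d : ℝ) else 0) (if Int.gcd u.1 u.2 = 1 then 1 else 0) := by
    intro u hu
    rw [← sum_divisors_moebius]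
    have := hasSum_sum_of_ne_finset_zero (L := .unconditional ℕ) (s := (Int.gcd u.1 u.2).divisors)
      (f := fun d : ℕ => if d ∣ Int.gcd u.1 u.2 then (ArithmeticFunction.moebius d : ℝ) else 0)
      (by
        intro d hd
        rw [if_neg fun h => hd (Nat.mem_divisors.2 ⟨h, hgcd u hu⟩)])
    rwa [Finset.sum_congr rfl fun d hd => if_pos (Nat.dvd_of_mem_divisors hd)] at this
  have hsum := (hasSum_sum hsingle).tsum_eq
  have hleft : ((primitiveVectors Q T).ncard : ℝ) =
      ∑ u ∈ hS.toFinset, if Int.gcd u.1 u.2 = 1 then (1 : ℝ) else 0 := by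
    rw [Finset.sum_boole, ← Set.ncard_coe_finset]
    congr 2
    ext u
    simp only [primitiveVectors, nonzeroVectors, Finset.coe_filter, Set.Finite.mem_toFinset,
      Set.mem_ofPred_eq]
    constructor
    · rintro ⟨h1, h2⟩
      refine ⟨⟨?_, h1⟩, h2⟩
      rintro rfl
      simp at h2
    · rintro ⟨⟨-, h1⟩, h2⟩
      exact ⟨h1, h2⟩
  rw [hleft, ← hsum]
  refine tsum_congr fun d => ?_
  rcases eq_or_ne d 0 with rfl | hd
  · simp
  · rw [nonzeroVectors_div_sq Q T hd, ← Finset.sum_filter, Finset.sum_const, nsmul_eq_mul,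
      mul_comm, ← Set.ncard_coe_finset]
    congr 3
    ext u
    simp

/-- A positive proportion `6 / π²` of the lattice points in a growing ellipse is primitive. -/
lemma tendsto_ncard_primitiveVectors_div {Q : ℤ × ℤ × ℤ} (hpos : ∀ u ≠ 0, 0 < evalForm Q u)
    (hfin : ∀ T : ℝ, {u : ℤ × ℤ | (evalForm Q u : ℝ) ≤ T}.Finite) {α : ℝ}
    (hlim : Tendsto (fun T : ℝ => ({u : ℤ × ℤ | (evalForm Q u : ℝ) ≤ T}.ncard : ℝ) / T) atTop
      (nhds α)) :
    Tendsto (fun T : ℝ => ((primitiveVectors Q T).ncard : ℝ) / T) atTop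
      (nhds (α * (6 / π ^ 2))) := by
  have hS : ∀ T, (nonzeroVectors Q T).Finite := fun T => (hfin T).subset fun u hu => hu.2
  have hlim' : Tendsto (fun T : ℝ => ((nonzeroVectors Q T).ncard : ℝ) / T) atTop (nhds α) := by
    have h := hlim.sub tendsto_inv_atTop_zero
    rw [sub_zero] at h
    refine h.congr' ?_
    filter_upwards [eventually_ge_atTop 0] with T hT
    have h0 : evalForm Q 0 = 0 := by simp [evalForm]
    have : {u : ℤ × ℤ | (evalForm Q u : ℝ) ≤ T} = insert 0 (nonzeroVectors Q T) := by
      ext u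
      simp only [nonzeroVectors, Set.mem_insert_iff, Set.mem_ofPred_eq]
      rcases eq_or_ne u 0 with rfl | hu
      · simpa [h0] using hT
      · simp [hu]
    rw [this, Set.ncard_insert_of_notMem (fun h => h.1 rfl) (hS T)]
    push_cast
    ring
  obtain ⟨C, hC⟩ : ∃ C : ℝ, ∀ T > 0, ((nonzeroVectors Q T).ncard : ℝ) ≤ C * T := by
    obtain ⟨T₀, hT₀⟩ := eventually_atTop.1 (hlim'.eventually (gt_mem_nhds (lt_add_one α)))
    refine ⟨max (α + 1) (nonzeroVectors Q T₀).ncard, fun T hT => ?_⟩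
    rcases le_total T₀ T with h | h
    · exact ((div_lt_iff₀ hT).1 (hT₀ T h)).le.trans
        (mul_le_mul_of_nonneg_right (le_max_left _ _) hT.le)
    · rcases lt_or_ge T 1 with h1 | h1
      · have : nonzeroVectors Q T = ∅ := by
          refine Set.eq_empty_of_forall_notMem fun u hu => ?_
          have h2 : (1 : ℝ) ≤ evalForm Q u := by exact_mod_cast hpos u hu.1
          linarith [hu.2]
        rw [this, Set.ncard_empty, Nat.cast_zero]
        exact mul_nonneg ((Nat.cast_nonneg _).trans (le_max_right _ _)) hT.le
      · have hmono : ((nonzeroVectors Q T).ncard : ℝ) ≤ (nonzeroVectors Q T₀).ncard :=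
          Nat.cast_le.2 (Set.ncard_le_ncard (fun u hu => ⟨hu.1, hu.2.trans h⟩) (hS T₀))
        have hmax := hmono.trans (le_max_right (α + 1) _)
        exact hmax.trans (le_mul_of_one_le_right ((Nat.cast_nonneg _).trans hmax) h1)
  have hmain : Tendsto (fun T : ℝ => ∑' d : ℕ, (ArithmeticFunction.moebius d : ℝ) *
      (nonzeroVectors Q (T / (d : ℝ) ^ 2)).ncard / T) atTop
      (nhds (∑' d : ℕ, α * ((ArithmeticFunction.moebius d : ℝ) / (d : ℝ) ^ 2))) := by
    refine tendsto_tsum_of_dominated_convergence (bound := fun d : ℕ => C * (1 / (d : ℝ) ^ 2))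
      ((Real.summable_one_div_nat_pow.2 one_lt_two).mul_left C) (fun d => ?_) ?_
    · rcases eq_or_ne d 0 with rfl | hd
      · simp
      · have hd' : (0 : ℝ) < (d : ℝ) ^ 2 := by positivity
        have h := (hlim'.comp (tendsto_id.atTop_div_const hd')).const_mul
          ((ArithmeticFunction.moebius d : ℝ) / (d : ℝ) ^ 2)
        rw [mul_comm] at h
        refine h.congr fun T => ?_
        simp only [Function.comp_apply, id_eq]
        field_simp
    · filter_upwards [eventually_gt_atTop 0] with T hT d
      rcases eq_or_ne d 0 with rfl | hd
      · simp
      · have hd' : (0 : ℝ) < (d : ℝ) ^ 2 := by positivity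
        have hmu : |(ArithmeticFunction.moebius d : ℝ)| ≤ 1 := by
          exact_mod_cast ArithmeticFunction.abs_moebius_le_one
        have hN := hC (T / (d : ℝ) ^ 2) (by positivity)
        rw [norm_div, norm_mul, Real.norm_eq_abs, Real.norm_eq_abs, Real.norm_eq_abs,
          Nat.abs_cast, abs_of_pos hT, div_le_iff₀ hT]
        calc |(ArithmeticFunction.moebius d : ℝ)| * ((nonzeroVectors Q (T / (d : ℝ) ^ 2)).ncard : ℝ)
            ≤ 1 * (nonzeroVectors Q (T / (d : ℝ) ^ 2)).ncard := by gcongr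
          _ ≤ C * (T / (d : ℝ) ^ 2) := by rwa [one_mul]
          _ = C * (1 / (d : ℝ) ^ 2) * T := by ring
  rw [tsum_mul_left, tsum_moebius_div_sq] at hmain
  refine hmain.congr fun T => ?_
  rw [ncard_primitiveVectors_eq_tsum hfin, tsum_div_const]

lemma omegaDisc_pos (d : ℤ) : 0 < omegaDisc d := by
  unfold omegaDisc
  split_ifs <;> norm_num

/-- The number of automorphs of a form of content `k` and discriminant `4n = d k² < 0`. -/
lemma card_automorphs {a b c n d : ℤ} {k : ℕ} (ha : a ≠ 0) (hn : n < 0)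
    (hdisc : b ^ 2 - 4 * a * c = 4 * n) (hcontent : Int.gcd a (Int.gcd b c) = k)
    (hd : 4 * n = d * (k : ℤ) ^ 2) :
    Nat.card {g | actForm g (a, b, c) = (a, b, c)} = omegaDisc d := by
  have hk : (k : ℤ) ≠ 0 := by
    rintro h
    rw [h] at hd
    linarith
  have hka : (k : ℤ) ∣ a := by rw [← hcontent]; exact Int.gcd_dvd_left _ _
  have hkg : (k : ℤ) ∣ (Int.gcd b c : ℤ) := by rw [← hcontent]; exact Int.gcd_dvd_right _ _
  obtain ⟨a', rfl⟩ := hka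
  obtain ⟨b', rfl⟩ := hkg.trans (Int.gcd_dvd_left _ _)
  obtain ⟨c', rfl⟩ := hkg.trans (Int.gcd_dvd_right _ _)
  have hprim : Int.gcd a' (Int.gcd b' c') = 1 := by
    rw [Int.gcd_mul_left, Int.natAbs_natCast, Nat.cast_mul, Int.gcd_mul_left,
      Int.natAbs_natCast] at hcontent
    exact Nat.eq_of_mul_eq_mul_left (Nat.pos_of_ne_zero (by exact_mod_cast hk))
      (by rw [hcontent, mul_one])
  have hd' : b' ^ 2 - 4 * a' * c' = d :=
    mul_right_cancel₀ (pow_ne_zero 2 hk) (by linear_combination hdisc + hd)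
  have hdneg : d < 0 := by
    by_contra! h
    nlinarith [mul_nonneg h (sq_nonneg (k : ℤ))]
  have hd3 : d ≤ -3 := by
    have h4 : b' ^ 2 % 4 = 0 ∨ b' ^ 2 % 4 = 1 := by
      rcases Int.even_or_odd' b' with ⟨m, rfl | rfl⟩
      · left; ring_nf; omega
      · right; ring_nf; omega
    have : d = b' ^ 2 - 4 * (a' * c') := by rw [← hd']; ring
    omega
  rw [card_automorphs_eq_card_pell (right_ne_zero_of_mul ha) hk hprim, hd',
    card_pell_eq_omegaDisc hd3]

/-- The orbit count for a positive definite form. -/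
lemma orbit_count_of_pos {a b c n d : ℤ} {k : ℕ} (ha : 0 < a) (hn : n < 0)
    (hdisc : b ^ 2 - 4 * a * c = 4 * n) (hcontent : Int.gcd a (Int.gcd b c) = k)
    (hd : 4 * n = d * (k : ℤ) ^ 2) :
    Tendsto (fun T : ℝ => (FTQ (a, b, c) T : ℝ) / T) atTop
      (nhds (6 / ((omegaDisc d : ℝ) * π * √|(n : ℝ)|))) := by
  have hω : (0 : ℝ) < omegaDisc d := by exact_mod_cast omegaDisc_pos d
  have hn' : (n : ℝ) < 0 := by exact_mod_cast hn
  have hfin := finite_evalForm_le ha hn hdisc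
  have hP := tendsto_ncard_primitiveVectors_div (fun u hu => evalForm_pos ha hn hdisc hu) hfin
    (tendsto_ncard_evalForm_le_div ha hn hdisc)
  have hcount : ∀ T : ℝ, (Nat.card {g | actForm g (a, b, c) ∈ coeffRegion T} : ℝ) =
      FTQ (a, b, c) T * omegaDisc d := by
    intro T
    rw [card_actForm_mem, card_automorphs ha.ne' hn hdisc hcontent hd, Nat.cast_mul, FTQ,
      ← Nat.card_coe_set_eq]
    simp only [coeffRegion, Set.mem_ofPred_eq, and_assoc]
  have herr : Tendsto (fun T : ℝ => ((FTQ (a, b, c) T : ℝ) * omegaDisc d -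
      (primitiveVectors (a, b, c) T).ncard) / T) atTop (nhds 0) := by
    refine squeeze_zero_norm' ?_ (tendsto_const_nhds.div_atTop tendsto_id :
      Tendsto (fun T : ℝ => ((primitiveVectors (a, b, c) (-n : ℤ)).ncard : ℝ) / T) atTop (nhds 0))
    filter_upwards [eventually_gt_atTop 0] with T hT
    rw [← hcount, norm_div, Real.norm_eq_abs, Real.norm_eq_abs, abs_of_pos hT]
    exact div_le_div_of_nonneg_right (abs_card_actForm_mem_sub_le ha hn hdisc T) hT.le
  have h := (herr.add hP).div_const (omegaDisc d : ℝ)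
  have hval : (0 + π / √(-n : ℝ) * (6 / π ^ 2)) / (omegaDisc d : ℝ) =
      6 / ((omegaDisc d : ℝ) * π * √|(n : ℝ)|) := by
    rw [abs_of_neg hn']
    have hpi := Real.pi_pos
    have hs : 0 < √(-n : ℝ) := Real.sqrt_pos.2 (by linarith)
    field_simp
    ring
  rw [hval] at h
  refine h.congr fun T => ?_
  field_simp
  ring

/-- **Theorem 2 (a).** For a negative integer `n` and an integral binary quadratic form
`Q = [a,b,c]` of discriminant `4n` and content `k` (so `d' = 4n/k²`), as `T → ∞` one has
`F_T^Q = 6T / (ω(d') π |n|^{1/2}) + o(T)`. -/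
theorem orbit_count_definite (n : ℤ) (hn : n < 0) (a b c : ℤ) (k : ℕ) (d' : ℤ)
    (hdisc : b ^ 2 - 4 * a * c = 4 * n)
    (hcontent : Int.gcd a (Int.gcd b c) = k)
    (hd' : 4 * n = d' * (k : ℤ) ^ 2) :
    (fun T : ℝ => (FTQ (a, b, c) T : ℝ) -
        6 * T / ((omegaDisc d' : ℝ) * Real.pi * Real.sqrt |(n : ℝ)|))
      =o[atTop] (fun T : ℝ => T) := by
  have key : Tendsto (fun T : ℝ => (FTQ (a, b, c) T : ℝ) / T) atTop
      (nhds (6 / ((omegaDisc d' : ℝ) * Real.pi * Real.sqrt |(n : ℝ)|))) := by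
    rcases lt_trichotomy a 0 with ha | rfl | ha
    · have h := orbit_count_of_pos (a := -a) (b := -b) (c := -c) (neg_pos.2 ha) hn
        (by linear_combination hdisc) (by simpa using hcontent) hd'
      refine h.congr fun T => ?_
      rw [← FTQ_neg (a, b, c) T]
      rfl
    · nlinarith [sq_nonneg b]
    · exact orbit_count_of_pos ha hn hdisc hcontent hd'
  rw [isLittleO_iff_tendsto' (by
    filter_upwards [eventually_ne_atTop 0] with T hT h
    exact absurd h hT)]
  have h := key.sub_const (6 / ((omegaDisc d' : ℝ) * Real.pi * Real.sqrt |(n : ℝ)|))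
  rw [sub_self] at h
  refine h.congr' ?_
  filter_upwards [eventually_ne_atTop 0] with T hT
  field_simp
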